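/- There is an absolute constant c > 0 with the following property: if A ⊆ F_2^n is a nonempty shift-minimal downset, K ≥ 1 is a real number with |A + A| ≤ K·|A|, and m := ⌊log₂ |A|⌋, then |A ∩ F_2^m| ≥ c·K^(−29)·|A|, where A ∩ F_2^m := {x ∈ A : x_i = 0 for all i > m}. -/

import Mathlib

open Finset Pointwise

abbrev F2 (n : ℕ) := Fin n → ZMod 2

/-- The standard basis vector `e i` of `F_2^n`. -/
def stdBasis {n : ℕ} (i : Fin n) : F2 n := Pi.single i 1

/-- `A` is a downset: whenever `x i = 0` and `x + e i ∈ A`, also `x ∈ A`. -/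
def IsDownset {n : ℕ} (A : Finset (F2 n)) : Prop :=
  ∀ x : F2 n, ∀ i : Fin n, x i = 0 → x + stdBasis i ∈ A → x ∈ A

/-- `A` is shift-minimal: whenever `i < j`, `x i = x j = 0` and `x + e j ∈ A`,
also `x + e i ∈ A`. -/
def IsShiftMinimal {n : ℕ} (A : Finset (F2 n)) : Prop :=
  ∀ x : F2 n, ∀ i j : Fin n, i < j → x i = 0 → x j = 0 →
    x + stdBasis j ∈ A → x + stdBasis i ∈ A

/-- The Hamming ball of radius `r` in `F_2^n`. -/
def hamBall (n r : ℕ) : Finset (F2 n) := Finset.univ.filter fun x => hammingNorm x ≤ r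

/-- The distance, in nats, of `binEntropy p` from its two extreme values `0` and `log 2`. -/
noncomputable def entropyDefect (p : ℝ) : ℝ :=
  min (Real.binEntropy p) (Real.log 2 - Real.binEntropy p)

lemma entropyDefect_nonneg {p : ℝ} (h0 : 0 ≤ p) (h1 : p ≤ 1) : 0 ≤ entropyDefect p :=
  le_min (Real.binEntropy_nonneg h0 h1) (sub_nonneg.2 Real.binEntropy_le_log_two)

lemma binEntropy_mono {p q : ℝ} (h0 : 0 ≤ p) (hpq : p ≤ q) (hq : q ≤ 1 / 2) :
    Real.binEntropy p ≤ Real.binEntropy q :=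
  Real.binEntropy_strictMonoOn.monotoneOn (by constructor <;> linarith)
    (by constructor <;> linarith) hpq

/-- Gibbs' variational inequality on two points. -/
lemma weighted_log_add_binEntropy_le {a b r : ℝ} (ha : 0 < a) (hb : 0 ≤ b) (h0 : 0 ≤ r)
    (h1 : r ≤ 1) (hrb : 0 < r → 0 < b) :
    (1 - r) * Real.log a + r * Real.log b + Real.binEntropy r ≤ Real.log (a + b) := by
  rcases h0.eq_or_lt with rfl | h0
  · simpa using Real.log_le_log ha (by linarith)
  have hb := hrb h0
  rcases h1.eq_or_lt with rfl | h1
  · simpa using Real.log_le_log hb (by linarith)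
  have h1' : 0 < 1 - r := by linarith
  have hab : 0 < a + b := by linarith
  have e1 := Real.log_le_sub_one_of_pos (show 0 < a / ((1 - r) * (a + b)) by positivity)
  have e2 := Real.log_le_sub_one_of_pos (show 0 < b / (r * (a + b)) by positivity)
  rw [Real.log_div (by positivity) (by positivity), Real.log_mul (by positivity) (by positivity)]
    at e1 e2
  have e3 := add_le_add (mul_le_mul_of_nonneg_left e1 h1'.le) (mul_le_mul_of_nonneg_left e2 h0.le)
  have e4 : (1 - r) * (a / ((1 - r) * (a + b)) - 1) + r * (b / (r * (a + b)) - 1) = 0 := by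
    field_simp
    ring
  rw [e4] at e3
  simp only [Real.binEntropy, Real.log_inv]
  linarith

/-- The chain rule for the entropy of a two-part partition. -/
lemma log_add_eq_weighted {a b : ℝ} (ha : 0 < a) (hb : 0 ≤ b) :
    Real.log (a + b) = (1 - b / (a + b)) * Real.log a + b / (a + b) * Real.log b
      + Real.binEntropy (b / (a + b)) := by
  have hab : 0 < a + b := by linarith
  have h : 1 - b / (a + b) = a / (a + b) := by field_simp; ring
  rcases hb.eq_or_lt with rfl | hb
  · simp
  simp only [Real.binEntropy, Real.log_inv, h]
  rw [Real.log_div ha.ne' hab.ne', Real.log_div hb.ne' hab.ne']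
  field_simp
  ring

lemma binEntropy_add_mul_le {p q : ℝ} (h0 : 0 ≤ p) (hp : p ≤ 1 / 2) (hq0 : 0 ≤ q)
    (hq : q ≤ 1 / 2) :
    Real.binEntropy q + 2 * p * (Real.log 2 - Real.binEntropy q)
      ≤ Real.binEntropy (p + q - 2 * p * q) := by
  have := Real.strictConcave_binEntropy.concaveOn.2
    (show q ∈ Set.Icc 0 1 by constructor <;> linarith)
    (show (2⁻¹ : ℝ) ∈ Set.Icc 0 1 by constructor <;> norm_num)
    (show 0 ≤ 1 - 2 * p by linarith) (show 0 ≤ 2 * p by linarith) (by ring)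
  simp only [smul_eq_mul, Real.binEntropy_two_inv] at this
  rw [show (1 - 2 * p) * q + 2 * p * 2⁻¹ = p + q - 2 * p * q by ring] at this
  linarith

lemma mul_log_inv_one_sub_le {p : ℝ} (hp : p < 1) : (1 - p) * Real.log (1 - p)⁻¹ ≤ p := by
  have h : 0 < 1 - p := by linarith
  have := mul_le_mul_of_nonneg_left (Real.log_le_sub_one_of_pos (inv_pos.2 h)) h.le
  rwa [mul_sub, mul_inv_cancel₀ h.ne', mul_one, sub_sub_cancel] at this

lemma le_log_inv_one_sub {p : ℝ} (hp : p < 1) : p ≤ Real.log (1 - p)⁻¹ := by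
  have := Real.log_le_sub_one_of_pos (show 0 < 1 - p by linarith)
  rw [Real.log_inv]
  linarith

lemma log_eight : Real.log 8 = 3 * Real.log 2 := by
  rw [show (8 : ℝ) = 2 ^ 3 by norm_num, Real.log_pow]; norm_num

lemma binEntropy_self_conv_of_small {p : ℝ} (h0 : 0 ≤ p) (hp : p ≤ 1 / 8) :
    5 / 4 * Real.binEntropy p ≤ Real.binEntropy (p + p - 2 * p * p) := by
  rcases h0.eq_or_lt with rfl | h0
  · simp
  refine le_trans ?_ (binEntropy_mono (p := 7 / 4 * p) (by linarith) (by nlinarith) (by nlinarith))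
  have hL : 3 * Real.log 2 ≤ Real.log p⁻¹ := by
    rw [← log_eight]
    exact Real.log_le_log (by norm_num) (by rw [le_inv_comm₀ (by norm_num) h0]; linarith)
  have h78 : Real.log (7 / 4) ≤ Real.log 2 - 1 / 8 := by
    have h := Real.log_le_sub_one_of_pos (show (0 : ℝ) < 7 / 8 by norm_num)
    rw [show (7 / 4 : ℝ) = 2 * (7 / 8) by norm_num, Real.log_mul (by norm_num) (by norm_num)]
    linarith
  have e1 := mul_log_inv_one_sub_le (show p < 1 by linarith)
  have e2 := mul_le_mul_of_nonneg_left (le_log_inv_one_sub (show 7 / 4 * p < 1 by linarith))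
    (show 0 ≤ 1 - 7 / 4 * p by linarith)
  have e3 : Real.log (7 / 4 * p)⁻¹ = Real.log p⁻¹ - Real.log (7 / 4) := by
    rw [Real.log_inv, Real.log_inv, Real.log_mul (by norm_num) h0.ne']
    ring
  have l2 := Real.log_two_gt_d9
  have l2' := Real.log_two_lt_d9
  simp only [Real.binEntropy, e3]
  have key : 0 ≤ p * (1 / 2 * Real.log p⁻¹ - 7 / 4 * Real.log (7 / 4) + 7 / 4 * (1 - 7 / 32)
      - 5 / 4) :=
    mul_nonneg h0.le (by linarith)
  have e4 : p * (7 / 4 * (7 / 4 * p)) ≤ p * (7 / 4 * (7 / 32)) :=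
    mul_le_mul_of_nonneg_left (by linarith) h0.le
  nlinarith

lemma entropyDefect_le_self_conv {p : ℝ} (h0 : 0 ≤ p) (hp : p ≤ 1 / 2) :
    entropyDefect p / 4 ≤ Real.binEntropy (p + p - 2 * p * p) - Real.binEntropy p := by
  rcases le_total p (1 / 8) with h | h
  · have := binEntropy_self_conv_of_small h0 h
    have := min_le_left (Real.binEntropy p) (Real.log 2 - Real.binEntropy p)
    unfold entropyDefect
    linarith
  · have h1 := binEntropy_add_mul_le h0 hp h0 hp
    have h2 := min_le_right (Real.binEntropy p) (Real.log 2 - Real.binEntropy p)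
    have h3 : 0 ≤ Real.log 2 - Real.binEntropy p := sub_nonneg.2 Real.binEntropy_le_log_two
    unfold entropyDefect
    nlinarith

/-- Adding independent bits of biases `p` and `q` gains entropy. -/
lemma binEntropy_conv_gain {p q : ℝ} (hp0 : 0 ≤ p) (hp : p ≤ 1 / 2) (hq0 : 0 ≤ q)
    (hq : q ≤ 1 / 2) :
    Real.binEntropy p + Real.binEntropy q + (entropyDefect p + entropyDefect q) / 9
      ≤ 2 * Real.binEntropy (p + q - 2 * p * q) := by
  wlog hpq : p ≤ q generalizing p q
  · have := this hq0 hq hp0 hp (le_of_not_ge hpq)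
    rw [show p + q - 2 * p * q = q + p - 2 * q * p by ring]
    linarith
  have h1 := entropyDefect_le_self_conv hp0 hp
  have h2 : Real.binEntropy (p + p - 2 * p * p) ≤ Real.binEntropy (p + q - 2 * p * q) :=
    binEntropy_mono (by nlinarith) (by nlinarith) (by nlinarith)
  have h3 : Real.binEntropy q ≤ Real.binEntropy (p + q - 2 * p * q) :=
    binEntropy_mono hq0 (by nlinarith) (by nlinarith)
  have h4 := binEntropy_mono hp0 hpq hq
  have h5 : entropyDefect q ≤ entropyDefect p + (Real.binEntropy q - Real.binEntropy p) := by
    unfold entropyDefect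
    rw [← min_add_add_right]
    exact min_le_min (by linarith) (by linarith)
  linarith

lemma binEntropy_le_entropyDefect {p : ℝ} (h0 : 0 ≤ p) (hp : p ≤ 1 / 8) :
    Real.binEntropy p ≤ 3 / 2 * entropyDefect p := by
  have h := binEntropy_mono h0 hp (by norm_num)
  have h8 : Real.binEntropy (1 / 8) ≤ 3 / 5 * Real.log 2 := by
    have := mul_log_inv_one_sub_le (show (1 / 8 : ℝ) < 1 by norm_num)
    have l2 := Real.log_two_gt_d9
    have e : Real.log (1 / 8)⁻¹ = 3 * Real.log 2 := by rw [← log_eight]; norm_num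
    rw [Real.binEntropy, e]
    linarith
  have h' := Real.binEntropy_nonneg h0 (by linarith : p ≤ 1)
  unfold entropyDefect
  rw [mul_min_of_nonneg _ _ (by norm_num)]
  exact le_min (by linarith) (by linarith)

lemma log_two_sub_binEntropy_le_entropyDefect {p : ℝ} (h0 : 1 / 16 ≤ p) (hp : p ≤ 1 / 2) :
    Real.log 2 - Real.binEntropy p ≤ 3 * entropyDefect p := by
  have h := binEntropy_mono (by norm_num) h0 hp
  have h16 : 1 / 4 * Real.log 2 ≤ Real.binEntropy (1 / 16) := by
    have e : Real.log (1 / 16)⁻¹ = 4 * Real.log 2 := by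
      rw [show ((1 / 16 : ℝ))⁻¹ = 2 ^ 4 by norm_num, Real.log_pow]; norm_num
    have := le_log_inv_one_sub (show (1 / 16 : ℝ) < 1 by norm_num)
    rw [Real.binEntropy, e]
    linarith
  have h' : 0 ≤ Real.log 2 - Real.binEntropy p := sub_nonneg.2 Real.binEntropy_le_log_two
  unfold entropyDefect
  rw [mul_min_of_nonneg _ _ (by norm_num)]
  exact le_min (by linarith) (by linarith)

/-- A smooth, decreasing, convex majorant of `D ↦ max (log 2 - D) 0`. -/
noncomputable def smoothNegPart (D : ℝ) : ℝ :=
  (√(D ^ 2 + 20 ^ 2) - D) / 2 + Real.log 2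

lemma log_two_sub_le_smoothNegPart (D : ℝ) : Real.log 2 - D ≤ smoothNegPart D := by
  have := Real.abs_le_sqrt (show D ^ 2 ≤ D ^ 2 + 20 ^ 2 by norm_num)
  have := neg_abs_le D
  rw [smoothNegPart]
  generalize √(D ^ 2 + 20 ^ 2) = s at *
  linarith

lemma smoothNegPart_nonneg (D : ℝ) : 0 ≤ smoothNegPart D := by
  have := Real.abs_le_sqrt (show D ^ 2 ≤ D ^ 2 + 20 ^ 2 by norm_num)
  have := le_abs_self D
  have : 0 < Real.log 2 := Real.log_pos one_lt_two
  rw [smoothNegPart]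
  generalize √(D ^ 2 + 20 ^ 2) = s at *
  linarith

lemma smoothNegPart_le {D : ℝ} (hD : 0 ≤ D) : smoothNegPart D ≤ 10 + Real.log 2 := by
  have : √(D ^ 2 + 20 ^ 2) ≤ D + 20 := Real.sqrt_le_iff.2 ⟨by linarith, by nlinarith⟩
  rw [smoothNegPart]
  generalize √(D ^ 2 + 20 ^ 2) = s at *
  linarith

lemma exists_smoothNegPart_add_le (D : ℝ) : ∃ l : ℝ, -1 ≤ l ∧ l ≤ 0 ∧
    ∀ d, smoothNegPart (D + d) ≤ smoothNegPart D + l * d + d ^ 2 / 80 := by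
  set s := √(D ^ 2 + 20 ^ 2) with hs
  have hD : |D| ≤ s := Real.abs_le_sqrt (by norm_num)
  have h20 : 20 ≤ s := Real.le_sqrt_of_sq_le (by nlinarith [sq_nonneg D])
  have hss : s ^ 2 = D ^ 2 + 20 ^ 2 := Real.sq_sqrt (by positivity)
  have hs0 : 0 < s := by linarith
  refine ⟨(D / s - 1) / 2, ?_, ?_, fun d ↦ ?_⟩
  · have : -1 ≤ D / s := by rw [le_div_iff₀ hs0]; linarith [neg_abs_le D]
    linarith
  · have : D / s ≤ 1 := by rw [div_le_iff₀ hs0]; linarith [le_abs_self D]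
    linarith
  · have key : √((D + d) ^ 2 + 20 ^ 2) ≤ s + D / s * d + d ^ 2 / (2 * s) := by
      have e : s + D / s * d + d ^ 2 / (2 * s) = (s ^ 2 + ((D + d) ^ 2 + 20 ^ 2)) / (2 * s) := by
        field_simp
        rw [hss]
        ring
      rw [e, le_div_iff₀ (by linarith)]
      have := Real.sq_sqrt (show 0 ≤ (D + d) ^ 2 + 20 ^ 2 by positivity)
      nlinarith [sq_nonneg (√((D + d) ^ 2 + 20 ^ 2) - s)]
    have h40 : d ^ 2 / (2 * s) ≤ d ^ 2 / 40 :=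
      div_le_div_of_nonneg_left (sq_nonneg d) (by norm_num) (by linarith)
    unfold smoothNegPart
    rw [← hs]
    linarith

lemma mul_sq_surprisal_le {x : ℝ} (h0 : 0 < x) (h1 : x ≤ 1) :
    x * (Real.log x⁻¹ - Real.log 2) ^ 2
      ≤ 4 * (1 / 2 - x - x * (Real.log x⁻¹ - Real.log 2)) := by
  set d := Real.log x⁻¹ - Real.log 2 with hd
  have hx : Real.exp d * (2 * x) = 1 := by
    rw [hd, Real.exp_sub, Real.exp_log (by positivity), Real.exp_log (by norm_num)]
    field_simp
  have h1 : 0 ≤ Real.log x⁻¹ := Real.log_nonneg (one_le_inv₀ h0 |>.2 h1)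
  have l2 := Real.log_two_lt_d9
  have h2 : (1 + d / 2) ^ 2 ≤ Real.exp d := by
    rw [show d = d / 2 + d / 2 by ring, Real.exp_add, ← sq, ← show d = d / 2 + d / 2 by ring]
    have := Real.add_one_le_exp (d / 2)
    exact pow_le_pow_left₀ (by linarith) (by linarith) 2
  nlinarith [mul_le_mul_of_nonneg_right h2 (show 0 ≤ 2 * x by linarith)]

lemma smoothNegPart_step {p : ℝ} (h0 : 0 < p) (hp : p < 1) (D : ℝ) :
    (1 - p) * smoothNegPart (D + (Real.log (1 - p)⁻¹ - Real.log 2))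
      + p * smoothNegPart (D + (Real.log p⁻¹ - Real.log 2))
      ≤ smoothNegPart D + 21 / 20 * (Real.log 2 - Real.binEntropy p) := by
  obtain ⟨l, hl, hl0, h⟩ := exists_smoothNegPart_add_le D
  have h' : 0 < 1 - p := by linarith
  have e1 := mul_le_mul_of_nonneg_left (h (Real.log (1 - p)⁻¹ - Real.log 2)) h'.le
  have e2 := mul_le_mul_of_nonneg_left (h (Real.log p⁻¹ - Real.log 2)) h0.le
  have e3 := mul_sq_surprisal_le h' (by linarith)
  have e4 := mul_sq_surprisal_le h0 hp.le
  have hk : 0 ≤ Real.log 2 - Real.binEntropy p := sub_nonneg.2 Real.binEntropy_le_log_two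
  have e5 : -l * (Real.log 2 - Real.binEntropy p) ≤ 1 * (Real.log 2 - Real.binEntropy p) :=
    mul_le_mul_of_nonneg_right (by linarith) hk
  simp only [Real.binEntropy] at *
  linarith

section Fibers

variable {n : ℕ}

/-- The fiber of `A` over the value `b` of the first coordinate. -/
def fiber (b : ZMod 2) (A : Finset (F2 (n + 1))) : Finset (F2 n) :=
  univ.filter fun x => (Fin.cons b x : F2 (n + 1)) ∈ A

@[simp] lemma mem_fiber {b : ZMod 2} {A : Finset (F2 (n + 1))} {x : F2 n} :
    x ∈ fiber b A ↔ (Fin.cons b x : F2 (n + 1)) ∈ A := by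
  simp [fiber]

lemma cons_add_cons (a b : ZMod 2) (x y : F2 n) :
    (Fin.cons a x : F2 (n + 1)) + (Fin.cons b y : F2 (n + 1)) = Fin.cons (a + b) (x + y) := by
  ext i
  refine Fin.cases ?_ (fun j ↦ ?_) i <;> simp

lemma stdBasis_succ (i : Fin n) : stdBasis i.succ = (Fin.cons 0 (stdBasis i) : F2 (n + 1)) := by
  ext j
  refine Fin.cases ?_ (fun j ↦ ?_) j <;> simp [stdBasis, Pi.single_apply]

lemma stdBasis_zero : stdBasis 0 = (Fin.cons 1 0 : F2 (n + 1)) := by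
  ext j
  refine Fin.cases ?_ (fun j ↦ ?_) j <;> simp [stdBasis]

lemma card_eq_card_fiber_add (A : Finset (F2 (n + 1))) :
    A.card = (fiber 0 A).card + (fiber 1 A).card := by
  have hb (b : ZMod 2) : (A.filter fun x ↦ x 0 = b).card = (fiber b A).card := by
    symm
    refine card_bij (fun x _ ↦ Fin.cons b x) (by simp) (fun x _ y _ h ↦ ?_) fun x hx ↦ ?_
    · exact (Fin.cons_injective2 h).2
    · obtain ⟨hx, rfl⟩ := mem_filter.1 hx
      exact ⟨Fin.tail x, by simpa using hx, by simp⟩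
  have h2 : ∀ z : ZMod 2, ¬ z = 0 ↔ z = 1 := by decide
  rw [← hb 0, ← hb 1, ← card_filter_add_card_filter_not (s := A) (fun x ↦ x 0 = 0)]
  simp only [h2]

lemma IsDownset.restrict {A : Finset (F2 (n + 1))} (hA : IsDownset A) (b : ZMod 2) :
    IsDownset (fiber b A) := by
  intro x i hx h
  rw [mem_fiber] at h ⊢
  refine hA _ i.succ (by simpa using hx) ?_
  rwa [stdBasis_succ, cons_add_cons, add_zero]

lemma IsShiftMinimal.restrict {A : Finset (F2 (n + 1))} (hA : IsShiftMinimal A)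
    (b : ZMod 2) :
    IsShiftMinimal (fiber b A) := by
  intro x i j hij hi hj h
  rw [mem_fiber] at h ⊢
  have := hA (Fin.cons b x) i.succ j.succ (by simpa using hij) (by simpa using hi)
    (by simpa using hj)
  rw [stdBasis_succ, stdBasis_succ, cons_add_cons, cons_add_cons, add_zero] at this
  exact this h

lemma IsDownset.fiber_one_subset {A : Finset (F2 (n + 1))} (hA : IsDownset A) :
    fiber 1 A ⊆ fiber 0 A := by
  intro x h
  rw [mem_fiber] at h ⊢
  refine hA _ 0 (by simp) ?_
  rwa [stdBasis_zero, cons_add_cons, add_zero, zero_add]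

lemma IsDownset.fiber_zero_nonempty {A : Finset (F2 (n + 1))} (hA : IsDownset A)
    (hne : A.Nonempty) : (fiber 0 A).Nonempty := by
  have h := card_eq_card_fiber_add A
  have h1 := card_le_card hA.fiber_one_subset
  have h2 := hne.card_pos
  exact card_pos.1 (by lia)

lemma IsShiftMinimal.fiber_one_fiber_zero_subset {A : Finset (F2 (n + 2))}
    (hA : IsShiftMinimal A) :
    fiber 1 (fiber 0 A) ⊆ fiber 0 (fiber 1 A) := by
  intro x h
  simp only [mem_fiber] at h ⊢
  have := hA (Fin.cons 0 (Fin.cons 0 x)) 0 (Fin.succ 0) (by simp) (by simp) (by simp)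
  rw [stdBasis_succ, stdBasis_zero, stdBasis_zero] at this
  simp only [cons_add_cons, add_zero, zero_add] at this
  exact this h

lemma fiber_add_fiber_subset {A B : Finset (F2 (n + 1))} (a b : ZMod 2) :
    fiber a A + fiber b B ⊆ fiber (a + b) (A + B) := by
  intro z hz
  obtain ⟨x, hx, y, hy, rfl⟩ := mem_add.1 hz
  rw [mem_fiber] at *
  rw [← cons_add_cons]
  exact add_mem_add hx hy

lemma IsDownset.zero_mem {A : Finset (F2 n)} (hA : IsDownset A) (hne : A.Nonempty) : 0 ∈ A := by
  induction n with
  | zero =>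
    obtain ⟨x, hx⟩ := hne
    rwa [Subsingleton.elim 0 x]
  | succ n ih =>
    have := ih (hA.restrict 0) (hA.fiber_zero_nonempty hne)
    rw [mem_fiber] at this
    rwa [show (0 : F2 (n + 1)) = (Fin.cons 0 0 : F2 (n + 1)) from
      (Fin.cons_self_tail (0 : F2 (n + 1))).symm]

/-- The intersection of `A` with the span of the first `m` basis vectors. -/
def initialPart (m : ℕ) (A : Finset (F2 n)) : Finset (F2 n) :=
  A.filter fun x => ∀ i : Fin n, m ≤ (i : ℕ) → x i = 0

lemma initialPart_nonempty {A : Finset (F2 n)} (hA : IsDownset A) (hne : A.Nonempty) (m : ℕ) :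
    (initialPart m A).Nonempty :=
  ⟨0, mem_filter.2 ⟨hA.zero_mem hne, fun _ _ ↦ rfl⟩⟩

lemma fiber_initialPart (m : ℕ) (b : ZMod 2) (A : Finset (F2 (n + 1))) :
    fiber b (initialPart (m + 1) A) = initialPart m (fiber b A) := by
  ext x
  simp [initialPart, Fin.forall_fin_succ]

end Fibers

/-- The proportion of points of `A` whose first coordinate is `1`. -/
noncomputable def firstDensity : ∀ {n : ℕ}, Finset (F2 n) → ℝ
  | 0, _ => 0
  | _ + 1, A => ((fiber 1 A).card : ℝ) / A.card

/-- The expectation, over a uniformly random `x ∈ A`, of the sum over all coordinates `i` of the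
entropy defect of the conditional law of `x i` given the preceding coordinates. -/
noncomputable def totalDefect : ∀ {n : ℕ}, Finset (F2 n) → ℝ
  | 0, _ => 0
  | _ + 1, A => entropyDefect (firstDensity A) + (1 - firstDensity A) * totalDefect (fiber 0 A)
      + firstDensity A * totalDefect (fiber 1 A)

section Entropy

variable {n : ℕ}

lemma firstDensity_nonneg (A : Finset (F2 n)) : 0 ≤ firstDensity A := by
  cases n <;> simp only [firstDensity] <;> positivity

lemma IsDownset.firstDensity_le_half {A : Finset (F2 n)} (hA : IsDownset A) :
    firstDensity A ≤ 1 / 2 := by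
  cases n with
  | zero => norm_num [firstDensity]
  | succ n =>
    have h1 : ((fiber 1 A).card : ℝ) ≤ (fiber 0 A).card := by
      exact_mod_cast card_le_card hA.fiber_one_subset
    have h : (A.card : ℝ) = (fiber 0 A).card + (fiber 1 A).card := by
      exact_mod_cast card_eq_card_fiber_add A
    exact div_le_of_le_mul₀ (by positivity) (by norm_num) (by linarith)

lemma fiber_one_nonempty_of_firstDensity_pos {A : Finset (F2 (n + 1))}
    (h : 0 < firstDensity A) : (fiber 1 A).Nonempty := by
  by_contra h'
  rw [not_nonempty_iff_eq_empty] at h'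
  simp [firstDensity, h'] at h

lemma firstDensity_mul_card (A : Finset (F2 (n + 1))) :
    firstDensity A * A.card = (fiber 1 A).card := by
  rcases A.eq_empty_or_nonempty with rfl | hne
  · simp [fiber]
  · have : (A.card : ℝ) ≠ 0 := by exact_mod_cast hne.card_pos.ne'
    exact div_mul_cancel₀ _ this

lemma one_sub_firstDensity_mul_card (A : Finset (F2 (n + 1))) :
    (1 - firstDensity A) * A.card = (fiber 0 A).card := by
  have h : (A.card : ℝ) = (fiber 0 A).card + (fiber 1 A).card := by
    exact_mod_cast card_eq_card_fiber_add A
  linarith [firstDensity_mul_card A]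

lemma IsDownset.totalDefect_nonneg {A : Finset (F2 n)} (hA : IsDownset A) :
    0 ≤ totalDefect A := by
  induction n with
  | zero => simp [totalDefect]
  | succ n ih =>
    have h0 := firstDensity_nonneg A
    have h1 := hA.firstDensity_le_half
    have := entropyDefect_nonneg h0 (by linarith)
    have := mul_nonneg (by linarith : 0 ≤ 1 - firstDensity A) (ih (hA.restrict 0))
    have := mul_nonneg h0 (ih (hA.restrict 1))
    simp only [totalDefect]
    linarith

lemma IsDownset.log_card_eq {A : Finset (F2 (n + 1))} (hA : IsDownset A) (hne : A.Nonempty) :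
    Real.log A.card = (1 - firstDensity A) * Real.log (fiber 0 A).card
      + firstDensity A * Real.log (fiber 1 A).card
      + Real.binEntropy (firstDensity A) := by
  have h : (A.card : ℝ) = (fiber 0 A).card + (fiber 1 A).card := by
    exact_mod_cast card_eq_card_fiber_add A
  have h0 : (0 : ℝ) < (fiber 0 A).card := by
    exact_mod_cast (hA.fiber_zero_nonempty hne).card_pos
  have := log_add_eq_weighted h0 (Nat.cast_nonneg (fiber 1 A).card)
  rwa [← h] at this

lemma log_card_fiber_one {A : Finset (F2 (n + 1))} (h : 0 < firstDensity A) :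
    Real.log A.card = Real.log (fiber 1 A).card + Real.log (firstDensity A)⁻¹ := by
  have h1 : (0 : ℝ) < (fiber 1 A).card := by
    exact_mod_cast (fiber_one_nonempty_of_firstDensity_pos h).card_pos
  rw [← Real.log_mul h1.ne' (by positivity), ← firstDensity_mul_card A]
  field_simp

lemma log_card_fiber_zero {A : Finset (F2 (n + 1))} (h : firstDensity A < 1) :
    Real.log A.card = Real.log (fiber 0 A).card + Real.log (1 - firstDensity A)⁻¹ := by
  have h' : 0 < 1 - firstDensity A := by linarith
  rw [← one_sub_firstDensity_mul_card A]
  rcases A.eq_empty_or_nonempty with rfl | hne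
  · simp_all [firstDensity]
  have : (A.card : ℝ) ≠ 0 := by exact_mod_cast hne.card_pos.ne'
  rw [Real.log_mul h'.ne' this, Real.log_inv]
  ring

/-- Sumsets of downsets: the entropy gain is bounded below by the total defects. -/
theorem IsDownset.log_card_add_totalDefect_le {A B : Finset (F2 n)} (hA : IsDownset A)
    (hB : IsDownset B) (hAne : A.Nonempty) (hBne : B.Nonempty) :
    Real.log A.card + Real.log B.card + (totalDefect A + totalDefect B) / 9
      ≤ 2 * Real.log (A + B).card := by
  induction n with
  | zero =>
    have h1 : (A.card : ℝ) ≤ (A + B).card := by exact_mod_cast card_le_card_add_right hBne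
    have h2 : (B.card : ℝ) ≤ (A + B).card := by exact_mod_cast card_le_card_add_left hAne
    have h3 := Real.log_le_log (by exact_mod_cast hAne.card_pos) h1
    have h4 := Real.log_le_log (by exact_mod_cast hBne.card_pos) h2
    simp only [totalDefect]
    linarith
  | succ n ih =>
    have key (w : ℝ) (a b c : ZMod 2) (hw : 0 ≤ w)
        (hne : 0 < w → (fiber a A).Nonempty ∧ (fiber b B).Nonempty)
        (hsub : fiber a A + fiber b B ⊆ fiber c (A + B)) :
        w * (Real.log (fiber a A).card + Real.log (fiber b B).card
          + (totalDefect (fiber a A) + totalDefect (fiber b B)) / 9)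
          ≤ w * (2 * Real.log (fiber c (A + B)).card) := by
      rcases hw.eq_or_lt with rfl | hw'
      · simp
      obtain ⟨h1, h2⟩ := hne hw'
      refine mul_le_mul_of_nonneg_left ((ih (hA.restrict a) (hB.restrict b) h1 h2).trans
        ?_) hw
      have : 0 < (fiber a A + fiber b B).card := (h1.add h2).card_pos
      gcongr
    have hp0 := firstDensity_nonneg A
    have hq0 := firstDensity_nonneg B
    have hp := hA.firstDensity_le_half
    have hq := hB.firstDensity_le_half
    have eA := hA.log_card_eq hAne
    have eB := hB.log_card_eq hBne
    have hA0 := hA.fiber_zero_nonempty hAne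
    have hB0 := hB.fiber_zero_nonempty hBne
    have hA1 := fiber_one_nonempty_of_firstDensity_pos (A := A)
    have hB1 := fiber_one_nonempty_of_firstDensity_pos (A := B)
    simp only [totalDefect]
    set p := firstDensity A
    set q := firstDensity B
    have s00 := fiber_add_fiber_subset (A := A) (B := B) 0 0
    have s01 := fiber_add_fiber_subset (A := A) (B := B) 0 1
    have s10 := fiber_add_fiber_subset (A := A) (B := B) 1 0
    have s11 := (add_subset_add hA.fiber_one_subset hB.fiber_one_subset).trans s00
    rw [add_zero] at s00 s10 s11
    rw [zero_add] at s01
    have k00 := key ((1 - p) * (1 - q)) 0 0 0 (mul_nonneg (by linarith) (by linarith))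
      (fun _ ↦ ⟨hA0, hB0⟩) s00
    have k01 := key ((1 - p) * q) 0 1 1 (mul_nonneg (by linarith) hq0)
      (fun h ↦ ⟨hA0, hB1 (pos_of_mul_pos_right h (by linarith))⟩) s01
    have k10 := key (p * (1 - q)) 1 0 1 (mul_nonneg hp0 (by linarith))
      (fun h ↦ ⟨hA1 (pos_of_mul_pos_left h (by linarith)), hB0⟩) s10
    have k11 := key (p * q) 1 1 0 (mul_nonneg hp0 hq0)
      (fun h ↦ ⟨hA1 (pos_of_mul_pos_left h hq0), hB1 (pos_of_mul_pos_right h hp0)⟩) s11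
    have hc : ((A + B).card : ℝ)
        = (fiber 0 (A + B)).card + (fiber 1 (A + B)).card := by
      exact_mod_cast card_eq_card_fiber_add (A + B)
    have hpos : (0 : ℝ) < (fiber 0 (A + B)).card := by
      exact_mod_cast ((hA0.add hB0).mono s00).card_pos
    have hr1 : 0 < p + q - 2 * p * q → (0 : ℝ) < (fiber 1 (A + B)).card := by
      intro h
      suffices (fiber 1 (A + B)).Nonempty by exact_mod_cast this.card_pos
      rcases hp0.eq_or_lt with hp' | hp'
      · exact (hA0.add (hB1 (by rw [← hp'] at h; linarith))).mono s01
      · exact ((hA1 hp').add hB0).mono s10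
    have hlog := weighted_log_add_binEntropy_le hpos (Nat.cast_nonneg _)
      (show 0 ≤ p + q - 2 * p * q by nlinarith) (by nlinarith) hr1
    rw [← hc] at hlog
    have hgain := binEntropy_conv_gain hp0 hp hq0 hq
    rw [eA, eB]
    linarith

/-- In a shift-minimal set the conditional densities form a supermartingale. -/
lemma IsShiftMinimal.firstDensity_fiber_le {A : Finset (F2 (n + 1))} (hA : IsShiftMinimal A)
    (hne : A.Nonempty) :
    (1 - firstDensity A) * firstDensity (fiber 0 A)
      + firstDensity A * firstDensity (fiber 1 A) ≤ firstDensity A := by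
  cases n with
  | zero => simpa [firstDensity] using firstDensity_nonneg A
  | succ n =>
    have hpos : (0 : ℝ) < A.card := by exact_mod_cast hne.card_pos
    refine le_of_mul_le_mul_right ?_ hpos
    have h0 := one_sub_firstDensity_mul_card A
    have h1 := firstDensity_mul_card A
    have h2 := firstDensity_mul_card (fiber 0 A)
    have h3 := firstDensity_mul_card (fiber 1 A)
    have h4 : ((fiber 1 (fiber 0 A)).card : ℝ)
        ≤ (fiber 0 (fiber 1 A)).card := by
      exact_mod_cast card_le_card hA.fiber_one_fiber_zero_subset
    have h5 : ((fiber 1 A).card : ℝ) = (fiber 0 (fiber 1 A)).card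
        + (fiber 1 (fiber 1 A)).card := by
      exact_mod_cast card_eq_card_fiber_add (fiber 1 A)
    calc _ = firstDensity (fiber 0 A) * ((1 - firstDensity A) * A.card)
          + firstDensity (fiber 1 A) * (firstDensity A * A.card) := by ring
      _ ≤ _ := by rw [h0, h1, h2, h3]; linarith

lemma one_sub_firstDensity_mul_log_card_le {A : Finset (F2 n)} (hA : IsDownset A)
    (hS : IsShiftMinimal A) (hne : A.Nonempty) :
    (1 - 8 * firstDensity A) * Real.log A.card ≤ 3 / 2 * totalDefect A := by
  induction n with
  | zero =>
    have h : A.card ≤ 1 := card_le_one_of_subsingleton A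
    have : (A.card : ℝ) = 1 := by exact_mod_cast le_antisymm h hne.card_pos
    simp [firstDensity, totalDefect, this]
  | succ n ih =>
    have hlog : 0 ≤ Real.log A.card := Real.log_natCast_nonneg _
    rcases le_total (1 / 8) (firstDensity A) with h | h
    · have := hA.totalDefect_nonneg
      nlinarith
    have h0 := firstDensity_nonneg A
    have hm := hS.firstDensity_fiber_le hne
    have hH := binEntropy_le_entropyDefect h0 h
    have d0 := firstDensity_nonneg (fiber 0 A)
    have d1 := firstDensity_nonneg (fiber 1 A)
    have k0 : (1 - 8 * firstDensity (fiber 0 A)) * Real.log A.card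
        ≤ 3 / 2 * totalDefect (fiber 0 A) + Real.log (1 - firstDensity A)⁻¹ := by
      have i0 := ih (hA.restrict 0) (hS.restrict 0) (hA.fiber_zero_nonempty hne)
      have hl : 0 ≤ Real.log (1 - firstDensity A)⁻¹ :=
        Real.log_nonneg ((one_le_inv₀ (by linarith)).2 (by linarith))
      rw [log_card_fiber_zero (A := A) (by linarith)]
      nlinarith
    have k1 : firstDensity A * ((1 - 8 * firstDensity (fiber 1 A)) * Real.log A.card)
        ≤ firstDensity A * (3 / 2 * totalDefect (fiber 1 A) + Real.log (firstDensity A)⁻¹) := by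
      rcases h0.eq_or_lt with h0' | h0'
      · simp [← h0']
      refine mul_le_mul_of_nonneg_left ?_ h0
      have i1 := ih (hA.restrict 1) (hS.restrict 1)
        (fiber_one_nonempty_of_firstDensity_pos h0')
      have hl : 0 ≤ Real.log (firstDensity A)⁻¹ :=
        Real.log_nonneg ((one_le_inv₀ h0').2 (by linarith))
      rw [log_card_fiber_one h0']
      nlinarith
    have k0' := mul_le_mul_of_nonneg_left k0 (show 0 ≤ 1 - firstDensity A by linarith)
    have hm' := mul_le_mul_of_nonneg_right hm hlog
    simp only [totalDefect]
    simp only [Real.binEntropy] at hH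
    linarith

lemma log_card_le_of_firstDensity_le {A : Finset (F2 n)} (hA : IsDownset A)
    (hS : IsShiftMinimal A) (hne : A.Nonempty) (h : firstDensity A ≤ 1 / 16) :
    Real.log A.card ≤ 3 * totalDefect A := by
  have h1 := one_sub_firstDensity_mul_log_card_le hA hS hne
  have hlog : 0 ≤ Real.log A.card := Real.log_natCast_nonneg _
  nlinarith

/-- A shift-minimal downset concentrates on the first `m` coordinates up to its total defect and
an error depending on how `|A|` compares with `2 ^ (m + 1)`. -/
theorem log_card_le_log_card_initialPart_add {A : Finset (F2 n)} (hA : IsDownset A)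
    (hS : IsShiftMinimal A) (hne : A.Nonempty) (m : ℕ) :
    Real.log A.card ≤ Real.log (initialPart m A).card + 29 / 9 * totalDefect A
      + smoothNegPart ((m + 1) * Real.log 2 - Real.log A.card) := by
  induction n generalizing m with
  | zero =>
    have h1 := log_card_le_of_firstDensity_le hA hS hne (by norm_num [firstDensity])
    have h2 : 0 ≤ Real.log (initialPart m A).card := Real.log_natCast_nonneg _
    have h3 := smoothNegPart_nonneg ((m + 1) * Real.log 2 - Real.log A.card)
    have h4 := hA.totalDefect_nonneg
    linarith
  | succ n ih =>
    have h4 := hA.totalDefect_nonneg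
    rcases le_total (firstDensity A) (1 / 16) with h | h
    · have h1 := log_card_le_of_firstDensity_le hA hS hne h
      have h2 : 0 ≤ Real.log (initialPart m A).card := Real.log_natCast_nonneg _
      have h3 := smoothNegPart_nonneg ((m + 1) * Real.log 2 - Real.log A.card)
      linarith
    cases m with
    | zero =>
      have h2 : 0 ≤ Real.log (initialPart 0 A).card := Real.log_natCast_nonneg _
      have h3 := log_two_sub_le_smoothNegPart (((0 : ℕ) + 1) * Real.log 2 - Real.log A.card)
      simp only [Nat.cast_zero, zero_add, one_mul] at h3 ⊢
      linarith
    | succ m =>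
      have hp0 : 0 < firstDensity A := by linarith
      have hp := hA.firstDensity_le_half
      have n0 := hA.fiber_zero_nonempty hne
      have n1 := fiber_one_nonempty_of_firstDensity_pos hp0
      have i0 := ih (hA.restrict 0) (hS.restrict 0) n0 m
      have i1 := ih (hA.restrict 1) (hS.restrict 1) n1 m
      have e0 := log_card_fiber_zero (A := A) (by linarith)
      have e1 := log_card_fiber_one hp0
      have hD := log_two_sub_binEntropy_le_entropyDefect h hp
      have hdef := entropyDefect_nonneg hp0.le (by linarith)
      have hstep := smoothNegPart_step hp0 (by linarith)
        (((m + 1 : ℕ) + 1) * Real.log 2 - Real.log A.card)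
      have hc : ((initialPart (m + 1) A).card : ℝ)
          = (initialPart m (fiber 0 A)).card + (initialPart m (fiber 1 A)).card := by
        rw [← fiber_initialPart, ← fiber_initialPart]
        exact_mod_cast card_eq_card_fiber_add _
      have c0 : (0 : ℝ) < (initialPart m (fiber 0 A)).card := by
        exact_mod_cast (initialPart_nonempty (hA.restrict 0) n0 m).card_pos
      have c1 : (0 : ℝ) < (initialPart m (fiber 1 A)).card := by
        exact_mod_cast (initialPart_nonempty (hA.restrict 1) n1 m).card_pos
      have hlog := weighted_log_add_binEntropy_le c0 c1.le hp0.le (by linarith) fun _ ↦ c1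
      rw [← hc] at hlog
      have eA := hA.log_card_eq hne
      rw [show ((m + 1 : ℕ) + 1) * Real.log 2 - Real.log A.card
          + (Real.log (1 - firstDensity A)⁻¹ - Real.log 2)
          = (m + 1) * Real.log 2 - Real.log (fiber 0 A).card by push_cast; linarith,
        show ((m + 1 : ℕ) + 1) * Real.log 2 - Real.log A.card
          + (Real.log (firstDensity A)⁻¹ - Real.log 2)
          = (m + 1) * Real.log 2 - Real.log (fiber 1 A).card by push_cast; linarith] at hstep
      have j0 := mul_le_mul_of_nonneg_left i0 (show 0 ≤ 1 - firstDensity A by linarith)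
      have j1 := mul_le_mul_of_nonneg_left i1 hp0.le
      simp only [totalDefect]
      linarith

end Entropy

/-- PFR for SMD sets, intersection version (Proposition 4.1): if `A` is a
nonempty shift-minimal downset with `|A+A| ≤ K|A|` and `m = ⌊log₂ |A|⌋`, then
`|A ∩ F_2^m| ≫ K^{-29} |A|`. -/
theorem pfr_smd_intersection :
    ∃ c : ℝ, 0 < c ∧
      ∀ (n : ℕ) (A : Finset (F2 n)), A.Nonempty → IsDownset A → IsShiftMinimal A →
        ∀ K : ℝ, 1 ≤ K → ((A + A).card : ℝ) ≤ K * A.card →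
        c * K ^ (-(29 : ℤ)) * A.card ≤
          ((A.filter fun x : F2 n =>
            ∀ i : Fin n, Nat.log 2 A.card ≤ (i : ℕ) → x i = 0).card : ℝ) := by
  refine ⟨Real.exp (-(10 + Real.log 2)), Real.exp_pos _, fun n A hne hA hS K hK hAA ↦ ?_⟩
  change _ ≤ ((initialPart (Nat.log 2 A.card) A).card : ℝ)
  set m := Nat.log 2 A.card
  have hK0 : 0 < K := by linarith
  have hA0 : (0 : ℝ) < A.card := by exact_mod_cast hne.card_pos
  have hI0 : (0 : ℝ) < (initialPart m A).card := by
    exact_mod_cast (initialPart_nonempty hA hne m).card_pos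
  have h1 := hA.log_card_add_totalDefect_le hA hne hne
  have h2 : Real.log (A + A).card ≤ Real.log K + Real.log A.card := by
    rw [← Real.log_mul hK0.ne' hA0.ne']
    exact Real.log_le_log (by exact_mod_cast (hne.add hne).card_pos) hAA
  have h3 := log_card_le_log_card_initialPart_add hA hS hne m
  have h4 : Real.log A.card ≤ (m + 1) * Real.log 2 := by
    have : (A.card : ℝ) ≤ 2 ^ (m + 1) := by
      exact_mod_cast (Nat.lt_pow_succ_log_self one_lt_two A.card).le
    have := Real.log_le_log hA0 this
    rw [Real.log_pow] at this
    exact_mod_cast this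
  have h5 := smoothNegPart_le (sub_nonneg.2 h4)
  rw [← Real.log_le_log_iff (by positivity) hI0, Real.log_mul (by positivity) hA0.ne',
    Real.log_mul (by positivity) (by positivity), Real.log_exp, Real.log_zpow]
  push_cast
  linarith
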